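/- arXiv:2102.04165 — 7 statements merged into one kernel-verified Lean document; each statement's English description precedes it below -/
import Mathlib

section
/- Let p be a prime number and let c be an integer with c ≥ 1. Then the quantity min{ (m − v_p(k)) + (p^m − k)·c : 0 < k < p^m } tends to infinity as m → ∞. Precisely: for every integer N there exists a natural number M such that for all m ≥ M and all natural numbers k with 0 < k < p^m, one has (m − v_p(k)) + (p^m − k)·c ≥ N. -/
/-- The `p`-adic valuation of `k < p ^ m` is less than the gap `p ^ m - k`. -/
theorem padicValNat_lt_pow_sub {p m k : ℕ} (hp : p.Prime) (hk : 0 < k) (hkm : k < p ^ m) :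
    padicValNat p k < p ^ m - k := by
  have hdvd : p ^ padicValNat p k ∣ k := pow_padicValNat_dvd
  have hlt : padicValNat p k < m :=
    (Nat.pow_lt_pow_iff_right hp.one_lt).1 ((Nat.le_of_dvd hk hdvd).trans_lt hkm)
  have hgap : p ^ padicValNat p k ∣ p ^ m - k :=
    Nat.dvd_sub (pow_dvd_pow p hlt.le) hdvd
  exact (Nat.lt_pow_self hp.one_lt).trans_le (Nat.le_of_dvd (Nat.sub_pos_of_lt hkm) hgap)

/-- For a prime `p` and an integer `c ≥ 1`, the quantity
`min { (m - v_p(k)) + (p^m - k) * c : 0 < k < p^m }` tends to infinity as `m → ∞`. -/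
theorem min_valuation_term_tendsto_atTop (p : ℕ) (hp : p.Prime) (c : ℤ) (hc : 1 ≤ c) :
    ∀ N : ℤ, ∃ M : ℕ, ∀ m : ℕ, M ≤ m → ∀ k : ℕ, 0 < k → k < p ^ m →
      N ≤ ((m : ℤ) - (padicValNat p k : ℤ)) + ((p : ℤ) ^ m - (k : ℤ)) * c := by
  intro N
  refine ⟨N.toNat, fun m hm k hk hkm => ?_⟩
  have hgap : (padicValNat p k : ℤ) < (p : ℤ) ^ m - k := by
    have h := padicValNat_lt_pow_sub hp hk hkm
    rw [← Nat.cast_pow, ← Nat.cast_sub hkm.le]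
    exact Nat.cast_lt.2 h
  have hmul : (p : ℤ) ^ m - k ≤ ((p : ℤ) ^ m - k) * c :=
    le_mul_of_one_le_right (by lia) hc
  lia
end

section
/- Let p be a prime, let R be a ring, and let w : R → ℤ ∪ {∞} be a filtration on R such that w(n·1_R) ≥ 0 for every integer n and w(p·1_R) ≥ 1. Let a, b ∈ R be commuting elements with w(a) = 0 and w(b) ≥ c for some integer c ≥ 1. Then for every natural number m, w((a+b)^{p^m} − a^{p^m}) ≥ min{ p^m·c , min_{0<k<p^m} ( (m − v_p(k)) + (p^m − k)·c ) }, where the inequality and the minimum are taken in ℤ ∪ {∞}. -/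
namespace RingFiltration

variable {R : Type*} [Ring R] {w : R → WithTop ℤ}

theorem le_sum (hw0 : w 0 = ⊤) (hwadd : ∀ r s : R, min (w r) (w s) ≤ w (r + s))
    {ι : Type*} (s : Finset ι) (f : ι → R) (B : WithTop ℤ) (h : ∀ i ∈ s, B ≤ w (f i)) :
    B ≤ w (∑ i ∈ s, f i) := by
  classical
  exact Finset.sum_induction f (fun x => B ≤ w x)
    (fun x y hx hy => (le_min hx hy).trans (hwadd x y)) (hw0 ▸ le_top) h

theorem mul_le_pow (hw1 : 0 ≤ w 1) (hwmul : ∀ r s : R, w r + w s ≤ w (r * s))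
    {x : R} {c : ℤ} (hx : (c : WithTop ℤ) ≤ w x) (n : ℕ) :
    ((n * c : ℤ) : WithTop ℤ) ≤ w (x ^ n) := by
  induction n with
  | zero => simpa using hw1
  | succ n ih =>
    rw [pow_succ]
    refine le_trans ?_ ((add_le_add ih hx).trans (hwmul _ _))
    rw [← WithTop.coe_add]
    exact WithTop.coe_le_coe.2 (by push_cast; linarith)

theorem le_natCast_of_pow_dvd (hwmul : ∀ r s : R, w r + w s ≤ w (r * s))
    (hwint : ∀ n : ℤ, 0 ≤ w (n : R)) {p : ℕ} (hwp : 1 ≤ w (p : R)) {e n : ℕ}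
    (h : p ^ e ∣ n) : ((e : ℤ) : WithTop ℤ) ≤ w (n : R) := by
  obtain ⟨d, rfl⟩ := h
  have hpow := mul_le_pow (by simpa using hwint 1) hwmul (c := 1) (by simpa using hwp) e
  have hd : 0 ≤ w (d : R) := by simpa using hwint d
  have := (add_le_add hpow hd).trans (hwmul _ _)
  simpa using this

end RingFiltration


/-- Let `w : R → ℤ ∪ {∞}` be a ring filtration with `w(n·1) ≥ 0` for all integers `n`
and `w(p·1) ≥ 1`.  If `a, b` commute, `w(a) = 0` and `w(b) ≥ c ≥ 1`, then for every `m`,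
`w((a+b)^{p^m} - a^{p^m}) ≥ min (p^m · c) (min_{0<k<p^m} ((m - v_p(k)) + (p^m - k)·c))`. -/
theorem filtration_pow_sub_pow_lower_bound (p : ℕ) (hp : p.Prime)
    {R : Type*} [Ring R] (w : R → WithTop ℤ)
    (hw0 : w 0 = ⊤)
    (hwadd : ∀ r s : R, min (w r) (w s) ≤ w (r + s))
    (hwmul : ∀ r s : R, w r + w s ≤ w (r * s))
    (hwint : ∀ n : ℤ, 0 ≤ w ((n : R)))
    (hwp : 1 ≤ w ((p : R)))
    (a b : R) (hab : a * b = b * a)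
    (ha : w a = 0) (c : ℤ) (hc : 1 ≤ c) (hb : (c : WithTop ℤ) ≤ w b) :
    ∀ m : ℕ,
      min (((p : ℤ) ^ m * c : ℤ) : WithTop ℤ)
        ((Finset.Ioo 0 (p ^ m)).inf fun k : ℕ =>
          ((((m : ℤ) - (padicValNat p k : ℤ)) + ((p : ℤ) ^ m - (k : ℤ)) * c : ℤ) : WithTop ℤ))
      ≤ w ((a + b) ^ p ^ m - a ^ p ^ m) := by
  intro m
  have hw1 : 0 ≤ w 1 := by simpa using hwint 1
  rw [(show Commute a b from hab).add_pow, Finset.sum_range_succ]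
  simp only [Nat.sub_self, pow_zero, mul_one, Nat.choose_self, Nat.cast_one, add_sub_cancel_right]
  refine RingFiltration.le_sum hw0 hwadd _ _ _ fun k hk => ?_
  have hkm : k < p ^ m := Finset.mem_range.1 hk
  have hak : 0 ≤ w (a ^ k) := by
    simpa using RingFiltration.mul_le_pow hw1 hwmul (c := 0) (by simp [ha]) k
  have hbk := RingFiltration.mul_le_pow hw1 hwmul hb (p ^ m - k)
  have habk := (add_le_add hak hbk).trans (hwmul _ _)
  rw [zero_add, Nat.cast_sub hkm.le, Nat.cast_pow] at habk
  rcases Nat.eq_zero_or_pos k with rfl | hk0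
  · refine (min_le_left _ _).trans ?_
    simpa using habk
  · refine (min_le_right _ _).trans
      ((Finset.inf_le (Finset.mem_Ioo.2 ⟨hk0, hkm⟩)).trans ?_)
    have hval : ((p ^ m).choose k).factorization p + padicValNat p k = m := by
      rw [← Nat.factorization_def k hp,
        Nat.factorization_choose_prime_pow_add_factorization hp hkm.le hk0.ne']
    have hchoose := RingFiltration.le_natCast_of_pow_dvd hwmul hwint hwp
      (Nat.ordProj_dvd ((p ^ m).choose k) p)
    refine le_trans ?_ ((add_le_add habk hchoose).trans (hwmul _ _))
    rw [← WithTop.coe_add]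
    exact WithTop.coe_le_coe.2 (by omega)
end

section
/- Let p be a prime, let R be a ring, and let w : R → ℤ ∪ {∞} be a filtration on R such that w(n·1_R) ≥ 0 for every integer n and w(p·1_R) ≥ 1. Let a, b ∈ R be commuting elements with w(a) = 0 and w(b) ≥ 1. Then (a+b)^{p^m} − a^{p^m} converges to 0 with respect to w as m → ∞: for every integer N there exists a natural number M such that for all m ≥ M, w((a+b)^{p^m} − a^{p^m}) ≥ N. -/
section Filtration

variable {R : Type*} [Ring R] {w : R → WithTop ℤ}

theorem filtration_le_mul (hwmul : ∀ r s : R, w r + w s ≤ w (r * s)) {i j : ℤ} {r s : R}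
    (hr : (i : WithTop ℤ) ≤ w r) (hs : (j : WithTop ℤ) ≤ w s) :
    ((i + j : ℤ) : WithTop ℤ) ≤ w (r * s) := by
  rw [WithTop.coe_add]
  exact (add_le_add hr hs).trans (hwmul r s)

theorem filtration_pow_nonneg (hwmul : ∀ r s : R, w r + w s ≤ w (r * s)) (h1 : 0 ≤ w 1)
    {r : R} (hr : 0 ≤ w r) (n : ℕ) : 0 ≤ w (r ^ n) := by
  induction n with
  | zero => simpa using h1
  | succ n ih =>
    rw [pow_succ]
    exact (add_nonneg ih hr).trans (hwmul _ _)

theorem filtration_le_pow (hwmul : ∀ r s : R, w r + w s ≤ w (r * s)) (h1 : 0 ≤ w 1)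
    {k : ℤ} (hk : 0 ≤ k) {r : R} (hr : (k : WithTop ℤ) ≤ w r) {n : ℕ} (hn : n ≠ 0) :
    (k : WithTop ℤ) ≤ w (r ^ n) := by
  obtain ⟨n, rfl⟩ := Nat.exists_eq_succ_of_ne_zero hn
  have hr0 : 0 ≤ w r := le_trans (by exact_mod_cast hk) hr
  rw [pow_succ]
  simpa using filtration_le_mul hwmul (i := 0) (filtration_pow_nonneg hwmul h1 hr0 n) hr

/-- Raising to the `p`-th power improves congruences by at least one step. -/
theorem filtration_le_add_pow_prime_sub_pow {p : ℕ} (hp : p.Prime)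
    (hw0 : w 0 = ⊤)
    (hwadd : ∀ r s : R, min (w r) (w s) ≤ w (r + s))
    (hwmul : ∀ r s : R, w r + w s ≤ w (r * s))
    (hwint : ∀ n : ℤ, 0 ≤ w ((n : R)))
    (hwp : 1 ≤ w ((p : R)))
    {a d : R} (had : Commute a d) (ha : 0 ≤ w a) {k : ℤ} (hk : 1 ≤ k)
    (hd : (k : WithTop ℤ) ≤ w d) :
    ((k + 1 : ℤ) : WithTop ℤ) ≤ w ((a + d) ^ p - a ^ p) := by
  have h1 : 0 ≤ w 1 := by simpa using hwint 1
  rw [had.add_pow_prime_eq' hp, add_assoc, add_sub_cancel_left]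
  refine le_trans (le_min ?_ ?_) (hwadd _ _)
  · obtain ⟨n, rfl⟩ := Nat.exists_eq_add_of_le' hp.two_le
    have h := filtration_le_mul hwmul
      (filtration_le_pow hwmul h1 (by lia) hd (Nat.succ_ne_zero n)) hd
    rw [← pow_succ] at h
    exact le_trans (by exact_mod_cast (by lia : k + 1 ≤ k + k)) h
  · rw [add_comm k 1]
    refine filtration_le_mul hwmul (by exact_mod_cast hwp) ?_
    refine Finset.sum_induction _ (fun x => (k : WithTop ℤ) ≤ w x)
      (fun x y hx hy => (le_min hx hy).trans (hwadd x y)) (by simp [hw0]) fun i hi => ?_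
    have hi' := Finset.mem_Ioo.1 hi
    have hmul := filtration_le_mul hwmul (i := 0) (filtration_pow_nonneg hwmul h1 ha i)
      (filtration_le_pow hwmul h1 (by lia) hd (Nat.sub_ne_zero_of_lt hi'.2))
    have hchoose : 0 ≤ w (((p.choose i / p : ℕ) : R)) := by
      simpa only [Int.cast_natCast] using hwint ((p.choose i / p : ℕ) : ℤ)
    simpa using filtration_le_mul hwmul (j := 0) hmul hchoose

end Filtration

/-- Let `w : R → ℤ ∪ {∞}` be a ring filtration with `w(n·1) ≥ 0` for all integers `n`
and `w(p·1) ≥ 1`.  If `a, b` commute, `w(a) = 0` and `w(b) ≥ 1`, then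
`(a+b)^{p^m} - a^{p^m} → 0` with respect to `w` as `m → ∞`. -/
theorem filtration_pow_sub_pow_tendsto_zero (p : ℕ) (hp : p.Prime)
    {R : Type*} [Ring R] (w : R → WithTop ℤ)
    (hw0 : w 0 = ⊤)
    (hwadd : ∀ r s : R, min (w r) (w s) ≤ w (r + s))
    (hwmul : ∀ r s : R, w r + w s ≤ w (r * s))
    (hwint : ∀ n : ℤ, 0 ≤ w ((n : R)))
    (hwp : 1 ≤ w ((p : R)))
    (a b : R) (hab : a * b = b * a)
    (ha : w a = 0) (hb : 1 ≤ w b) :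
    ∀ N : ℤ, ∃ M : ℕ, ∀ m : ℕ, M ≤ m →
      (N : WithTop ℤ) ≤ w ((a + b) ^ p ^ m - a ^ p ^ m) := by
  have h1 : 0 ≤ w 1 := by simpa using hwint 1
  have key : ∀ m : ℕ, ((m + 1 : ℤ) : WithTop ℤ) ≤ w ((a + b) ^ p ^ m - a ^ p ^ m) := by
    intro m
    induction m with
    | zero => simpa using hb
    | succ m ih =>
      have hcomm : Commute (a ^ p ^ m) ((a + b) ^ p ^ m - a ^ p ^ m) :=
        (((Commute.refl a).add_right hab).pow_pow _ _).sub_right (Commute.refl _)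
      have h := filtration_le_add_pow_prime_sub_pow hp hw0 hwadd hwmul hwint hwp hcomm
        (filtration_pow_nonneg hwmul h1 ha.ge _) (by lia) ih
      rw [add_sub_cancel, ← pow_mul, ← pow_mul, ← pow_succ] at h
      exact_mod_cast h
  intro N
  refine ⟨N.toNat, fun m hm => le_trans ?_ (key m)⟩
  exact_mod_cast (by lia : N ≤ (m : ℤ) + 1)
end

section
/- Let K be a field equipped with a valuation v : K → ℝ≥0, let f_1, …, f_d ∈ K[t] be polynomials, each of degree ≥ 1 and each with constant coefficient of valuation ≤ 1, and let β ∈ K with 0 < v(β) < 1. For each natural number i set μ_i := max_{1 ≤ j ≤ d} χ(β^i·f_j), where for a polynomial g of degree n ≥ 1, χ(g) := max_{1 ≤ l ≤ n} v(b_l)^{1/l} and b_l is the coefficient of t^l in g. Then the sequence (μ_i) is strictly decreasing: μ_{i+1} < μ_i for all i ≥ 0. -/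
open scoped NNReal

/-- Let `v` be a rank-one valuation on a field `K`, `f_1, …, f_d ∈ K[t]` polynomials of
degree `≥ 1` with constant coefficients of valuation `≤ 1`, and `β` with `0 < v(β) < 1`.
Setting `μ_i := max_{1 ≤ j ≤ d} χ(β^i · f_j)`, where
`χ(g) := max_{1 ≤ l ≤ deg g} v(b_l)^{1/l}`, the sequence `(μ_i)` is strictly
decreasing. -/
theorem mu_strict_anti (K : Type*) [Field K] (v : Valuation K ℝ≥0)
    (d : ℕ) (hd : 1 ≤ d) (f : Fin d → Polynomial K)
    (hdeg : ∀ j, 1 ≤ (f j).natDegree)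
    (h0 : ∀ j, v ((f j).coeff 0) ≤ 1)
    (β : K) (hβ0 : 0 < v β) (hβ1 : v β < 1) :
    ∀ i : ℕ,
      (Finset.univ.sup fun j : Fin d =>
          (Finset.Icc 1 (f j).natDegree).sup fun l =>
            (v (β ^ (i + 1) * (f j).coeff l)) ^ (1 / (l : ℝ)))
        < (Finset.univ.sup fun j : Fin d =>
          (Finset.Icc 1 (f j).natDegree).sup fun l =>
            (v (β ^ i * (f j).coeff l)) ^ (1 / (l : ℝ))) := by
  intro i
  have le_sup : ∀ (j : Fin d), ∀ l ∈ Finset.Icc 1 (f j).natDegree,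
      (v (β ^ i * (f j).coeff l)) ^ (1 / (l : ℝ)) ≤
        Finset.univ.sup fun j : Fin d =>
          (Finset.Icc 1 (f j).natDegree).sup fun l =>
            (v (β ^ i * (f j).coeff l)) ^ (1 / (l : ℝ)) := fun j l hl =>
    (Finset.le_sup (f := fun l : ℕ => (v (β ^ i * (f j).coeff l)) ^ (1 / (l : ℝ))) hl).trans
      (Finset.le_sup (f := fun j : Fin d => (Finset.Icc 1 (f j).natDegree).sup fun l =>
        (v (β ^ i * (f j).coeff l)) ^ (1 / (l : ℝ))) (Finset.mem_univ j))
  have hβ : β ≠ 0 := v.pos_iff.mp hβ0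
  have sup_pos : 0 < Finset.univ.sup fun j : Fin d =>
      (Finset.Icc 1 (f j).natDegree).sup fun l =>
        (v (β ^ i * (f j).coeff l)) ^ (1 / (l : ℝ)) := by
    let j : Fin d := ⟨0, hd⟩
    have hf : (f j).leadingCoeff ≠ 0 :=
      Polynomial.leadingCoeff_ne_zero.mpr (Polynomial.ne_zero_of_natDegree_gt (hdeg j))
    exact (NNReal.rpow_pos (v.pos_iff.mpr (mul_ne_zero (pow_ne_zero i hβ) hf))).trans_le
      (le_sup j _ (Finset.mem_Icc.mpr ⟨hdeg j, le_rfl⟩))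
  refine (Finset.sup_lt_iff sup_pos).mpr fun j _ => (Finset.sup_lt_iff sup_pos).mpr fun l hl => ?_
  have hl0 : 0 < 1 / (l : ℝ) :=
    one_div_pos.mpr (Nat.cast_pos.mpr (Finset.mem_Icc.mp hl).1)
  by_cases hc : (f j).coeff l = 0
  · simpa only [hc, mul_zero, map_zero, NNReal.zero_rpow hl0.ne'] using sup_pos
  · refine (NNReal.rpow_lt_rpow ?_ hl0).trans_le (le_sup j l hl)
    have hpos : 0 < v (β ^ i * (f j).coeff l) :=
      v.pos_iff.mpr (mul_ne_zero (pow_ne_zero i hβ) hc)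
    rw [pow_succ', mul_assoc, map_mul]
    exact mul_lt_of_lt_one_left hpos hβ1
end

section
/- Let p be an odd prime, let L be an algebraically closed field of characteristic zero, and let v : L → ℝ≥0 be a valuation with 0 < v(p·1_L) < 1. Let r ≥ 1 and let f_1, …, f_r ∈ L[t] be polynomials, each of degree ≥ 1, all of whose coefficients have valuation ≤ 1. Then there exist α ∈ L and k ∈ {1, …, r} such that v(f_i(α)) ≤ v(p·1_L)^{−1} for all i = 1, …, r, and v(f_k(α))^{p−1} · v(p·1_L)^{p−2} > 1. -/
open scoped NNReal

open Polynomial in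
/-- If no root of `g` has smaller valuation than `x`, then `v (g x) ≤ v (g 0)`. -/
theorem Valuation.eval_le_eval_zero_of_le_roots {L Γ : Type*} [Field L] [IsAlgClosed L]
    [LinearOrderedCommGroupWithZero Γ] (v : Valuation L Γ) (g : L[X]) (x : L)
    (hx : ∀ y ∈ g.roots, v x ≤ v y) : v (g.eval x) ≤ v (g.eval 0) := by
  have hs := IsAlgClosed.splits g
  rw [hs.eval_eq_prod_roots, hs.eval_eq_prod_roots, map_mul, map_mul, map_multiset_prod,
    map_multiset_prod, Multiset.map_map, Multiset.map_map]
  refine mul_le_mul_right (Multiset.prod_map_le_prod_map₀ _ _ (fun _ _ ↦ zero_le) ?_) _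
  intro y hy
  simpa using v.map_sub_le (hx y hy) le_rfl

/-- Let `p` be an odd prime, `L` an algebraically closed field of characteristic zero,
and `v` a valuation on `L` with `0 < v(p) < 1`.  Given nonconstant polynomials
`f_1, …, f_r ∈ L[t]` all of whose coefficients have valuation `≤ 1`, there exist
`α ∈ L` and `k` such that `v(f_i(α)) ≤ v(p)⁻¹` for all `i`, and
`v(f_k(α))^{p-1} · v(p)^{p-2} > 1`. -/
theorem exists_point_small_valuation (p : ℕ) (hp : p.Prime) (hodd : Odd p)
    (L : Type*) [Field L] [IsAlgClosed L] [CharZero L]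
    (v : Valuation L ℝ≥0) (hp0 : 0 < v ((p : L))) (hp1 : v ((p : L)) < 1)
    (r : ℕ) (hr : 1 ≤ r) (f : Fin r → Polynomial L)
    (hdeg : ∀ i, 1 ≤ (f i).natDegree)
    (hcoeff : ∀ i n, v ((f i).coeff n) ≤ 1) :
    ∃ (α : L) (k : Fin r),
      (∀ i, v ((f i).eval α) ≤ (v ((p : L)))⁻¹) ∧
      1 < (v ((f k).eval α)) ^ (p - 1) * (v ((p : L))) ^ (p - 2) := by
  classical
  have hpinv : 1 < (v (p : L))⁻¹ := (one_lt_inv₀ hp0).2 hp1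
  have hdeg' (i : Fin r) : (f i - Polynomial.C (p : L)⁻¹).natDegree ≠ 0 := by
    rw [Polynomial.natDegree_sub_C]
    exact Nat.one_le_iff_ne_zero.1 (hdeg i)
  have hg (i : Fin r) : f i - Polynomial.C (p : L)⁻¹ ≠ 0 := by
    intro h
    exact hdeg' i (by rw [h, Polynomial.natDegree_zero])
  let S : Finset (Fin r × L) :=
    Finset.univ.biUnion fun i ↦
      (f i - Polynomial.C (p : L)⁻¹).roots.toFinset.image (Prod.mk i)
  have mem_S (i : Fin r) (y : L) :
      (i, y) ∈ S ↔ y ∈ (f i - Polynomial.C (p : L)⁻¹).roots := by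
    simp [S]
  have hS : S.Nonempty := by
    obtain ⟨y, hy⟩ := IsAlgClosed.exists_root (f ⟨0, hr⟩ - Polynomial.C (p : L)⁻¹)
      (fun h ↦ hdeg' ⟨0, hr⟩ (Polynomial.natDegree_eq_of_degree_eq_some h))
    exact ⟨(⟨0, hr⟩, y), (mem_S _ _).2 ((Polynomial.mem_roots (hg _)).2 hy)⟩
  obtain ⟨⟨k, α⟩, hk, hmin⟩ := S.exists_min_image (fun z ↦ v z.2) hS
  have hα : (f k).eval α = (p : L)⁻¹ := by
    have h := (Polynomial.mem_roots (hg k)).1 ((mem_S k α).1 hk)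
    simpa [Polynomial.IsRoot, sub_eq_zero] using h
  refine ⟨α, k, fun i ↦ ?_, ?_⟩
  · have h := v.eval_le_eval_zero_of_le_roots (f i - Polynomial.C (p : L)⁻¹) α
      fun y hy ↦ hmin (i, y) ((mem_S i y).2 hy)
    simp only [Polynomial.eval_sub, Polynomial.eval_C] at h
    have h0 : v ((f i).eval 0 - (p : L)⁻¹) ≤ (v (p : L))⁻¹ := by
      refine v.map_sub_le ?_ (map_inv₀ v _).le
      rw [← Polynomial.coeff_zero_eq_eval_zero]
      exact (hcoeff i 0).trans hpinv.le
    simpa using v.map_add_le (h.trans h0) (map_inv₀ v (p : L)).le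
  · have hp2 : p - 1 = (p - 2) + 1 := by have := hp.two_le; omega
    rw [hα, map_inv₀, hp2, pow_succ, mul_right_comm, ← mul_pow, inv_mul_cancel₀ hp0.ne',
      one_pow, one_mul]
    exact hpinv
end

section
/- Let p be an odd prime, let L be an algebraically closed field of characteristic zero, and let v : L → ℝ≥0 be a valuation with 0 < v(p·1_L) < 1. Let m ≥ 0, let r ≥ 1, and let f_1, …, f_r be polynomials in the m+1 variables t_0, …, t_m over L, all of whose coefficients have valuation ≤ 1, and suppose that each f_i has positive degree in the last variable t_m. Then there exist α = (α_0, …, α_m) ∈ L^{m+1} and k ∈ {1, …, r} such that v(f_i(α)) ≤ v(p·1_L)^{−1} for all i = 1, …, r, and v(f_k(α))^{p−1} · v(p·1_L)^{p−2} > 1. -/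
open scoped NNReal

/-- On the disc centred at `0` whose radius does not exceed the valuation of any root, a polynomial
over an algebraically closed valued field is bounded by its value at `0`. -/
theorem Valuation.map_eval_le_map_eval_zero {L : Type*} [Field L] [IsAlgClosed L]
    (v : Valuation L ℝ≥0) (g : Polynomial L) {x : L}
    (hx : ∀ b ∈ g.roots, v x ≤ v b) : v (g.eval x) ≤ v (g.eval 0) := by
  have hs : g.Splits := IsAlgClosed.splits g
  rw [hs.eval_eq_prod_roots, hs.eval_eq_prod_roots, map_mul, map_mul,
    map_multiset_prod, map_multiset_prod, Multiset.map_map, Multiset.map_map]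
  refine mul_le_mul_right (Multiset.prod_map_le_prod_map₀ _ _ (fun _ _ => zero_le) ?_) _
  intro b hb
  simpa using v.map_sub_le (hx b hb) le_rfl

/-- Nonconstant polynomials over an algebraically closed valued field whose values at `0` have
valuation less than that of `c` are simultaneously bounded by `v c` at a point where one of them
takes the value `c`. -/
theorem Valuation.exists_eval_eq_forall_map_eval_le {L ι : Type*} [Field L] [IsAlgClosed L]
    [Finite ι] [Nonempty ι] (v : Valuation L ℝ≥0) (c : L) (h : ι → Polynomial L)
    (hdeg : ∀ i, (h i).natDegree ≠ 0) (h0 : ∀ i, v ((h i).eval 0) < v c) :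
    ∃ (x : L) (k : ι), (h k).eval x = c ∧ ∀ i, v ((h i).eval x) ≤ v c := by
  set g : ι → Polynomial L := fun i => h i - Polynomial.C c with hg
  have hgdeg (i) : (g i).natDegree ≠ 0 := by simpa [hg] using hdeg i
  have hg0 (i) : g i ≠ 0 := fun H => hgdeg i (by simp [H])
  let S : Set L := ⋃ i, {x | x ∈ (g i).roots}
  have hfin : S.Finite := Set.finite_iUnion fun i => by
    classical
    exact (g i).roots.toFinset.finite_toSet.subset fun x hx => by simpa using hx
  have hne : S.Nonempty := by
    obtain ⟨i⟩ := ‹Nonempty ι›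
    obtain ⟨x, hx⟩ := IsAlgClosed.exists_root (g i)
      (fun H => hgdeg i (Polynomial.natDegree_eq_of_degree_eq_some H))
    exact ⟨x, Set.mem_iUnion.2 ⟨i, (Polynomial.mem_roots (hg0 i)).2 hx⟩⟩
  obtain ⟨x, hxS, hmin⟩ := Set.exists_min_image S v hfin hne
  obtain ⟨k, hk⟩ := Set.mem_iUnion.1 hxS
  refine ⟨x, k, ?_, fun i => ?_⟩
  · have := (Polynomial.mem_roots (hg0 k)).1 hk
    simpa [hg, sub_eq_zero] using this
  · have hle := v.map_eval_le_map_eval_zero (g i) (x := x)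
      fun b hb => hmin b (Set.mem_iUnion.2 ⟨i, hb⟩)
    have hle' : v ((g i).eval x) ≤ v c :=
      hle.trans (by simpa [hg] using v.map_sub_le (h0 i).le le_rfl)
    simpa [hg] using v.map_add_le hle' le_rfl

/-- Finitely many nonconstant polynomials over an infinite domain admit a common point at which
none of them takes its value at the origin. -/
theorem MvPolynomial.exists_forall_eval_ne_constantCoeff {R σ ι : Type*} [CommRing R] [IsDomain R]
    [Infinite R] [Finite ι] (f : ι → MvPolynomial σ R) (hf : ∀ i, f i ≠ C (constantCoeff (f i))) :
    ∃ a : σ → R, ∀ i, eval a (f i) ≠ constantCoeff (f i) := by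
  have := Fintype.ofFinite ι
  have hne : ∏ i, (f i - C (constantCoeff (f i))) ≠ 0 :=
    Finset.prod_ne_zero_iff.2 fun i _ => sub_ne_zero.2 (hf i)
  by_contra! H
  refine hne (MvPolynomial.funext fun a => ?_)
  obtain ⟨i, hi⟩ := H a
  rw [map_prod, map_zero]
  exact Finset.prod_eq_zero (Finset.mem_univ i) (by simp [hi])

/-- Multivariable version: let `p` be an odd prime, `L` an algebraically closed field of
characteristic zero, and `v` a valuation on `L` with `0 < v(p) < 1`.  Given polynomials
`f_1, …, f_r` in the variables `t_0, …, t_m` over `L`, all of whose coefficients have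
valuation `≤ 1` and each of positive degree in the last variable `t_m`, there exist
`α ∈ L^{m+1}` and `k` such that `v(f_i(α)) ≤ v(p)⁻¹` for all `i`, and
`v(f_k(α))^{p-1} · v(p)^{p-2} > 1`. -/
theorem exists_point_small_valuation_mv (p : ℕ) (hp : p.Prime) (hodd : Odd p)
    (L : Type*) [Field L] [IsAlgClosed L] [CharZero L]
    (v : Valuation L ℝ≥0) (hp0 : 0 < v ((p : L))) (hp1 : v ((p : L)) < 1)
    (m : ℕ) (r : ℕ) (hr : 1 ≤ r) (f : Fin r → MvPolynomial (Fin (m + 1)) L)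
    (hcoeff : ∀ i d, v (MvPolynomial.coeff d (f i)) ≤ 1)
    (hdeg : ∀ i, 1 ≤ (f i).degreeOf (Fin.last m)) :
    ∃ (α : Fin (m + 1) → L) (k : Fin r),
      (∀ i, v (MvPolynomial.eval α (f i)) ≤ (v ((p : L)))⁻¹) ∧
      1 < (v (MvPolynomial.eval α (f k))) ^ (p - 1) * (v ((p : L))) ^ (p - 2) := by
  have hpow : (1 : ℝ≥0) < (v (p : L))⁻¹ := (one_lt_inv₀ hp0).2 hp1
  have : Nonempty (Fin r) := ⟨⟨0, hr⟩⟩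
  have hnc (i) : f i ≠ MvPolynomial.C (MvPolynomial.constantCoeff (f i)) := fun H => by
    have := hdeg i
    rw [H, MvPolynomial.degreeOf_C] at this
    omega
  obtain ⟨a, ha⟩ := MvPolynomial.exists_forall_eval_ne_constantCoeff f hnc
  let h : Fin r → Polynomial L := fun i =>
    MvPolynomial.aeval (fun j => Polynomial.C (a j) * Polynomial.X) (f i)
  have heval (i) (x : L) : (h i).eval x = MvPolynomial.eval (fun j => a j * x) (f i) := by
    simp only [h]
    induction f i using MvPolynomial.induction_on <;> simp_all
  have hzero (i) : (h i).eval 0 = MvPolynomial.constantCoeff (f i) := by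
    rw [heval, ← MvPolynomial.eval_zero]
    simp [Pi.zero_def]
  have hdeg' (i) : (h i).natDegree ≠ 0 := fun H => by
    refine ha i ?_
    rw [← hzero i]
    have h1 : (h i).eval 1 = MvPolynomial.eval a (f i) := by simp [heval]
    rw [← h1, Polynomial.eq_C_of_natDegree_eq_zero H, Polynomial.eval_C, Polynomial.eval_C]
  obtain ⟨x, k, hk, hle⟩ := v.exists_eval_eq_forall_map_eval_le ((p : L)⁻¹) h hdeg' fun i => by
    rw [hzero, map_inv₀, MvPolynomial.constantCoeff_eq]
    exact (hcoeff i 0).trans_lt hpow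
  refine ⟨fun j => a j * x, k, fun i => ?_, ?_⟩
  · simpa [heval] using hle i
  · have hpred : p - 1 = p - 2 + 1 := by have := hp.two_le; omega
    rw [← heval, hk, map_inv₀, hpred, pow_succ, mul_right_comm, ← mul_pow,
      inv_mul_cancel₀ hp0.ne', one_pow, one_mul]
    exact hpow
end

section
/- Let p be a prime and let F be a field of characteristic zero containing a primitive p-th root of unity ζ. Let r ∈ F be an element that has no p-th root in F (i.e., x^p ≠ r for all x ∈ F), let α be an element of the algebraic closure of F with α^p = r, and let F' = F(α) be the subfield of the algebraic closure generated by α over F. Then every β ∈ F' with β^p ∈ F can be written as β = c·α^m for some c ∈ F and some natural number m with 0 ≤ m < p. -/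
open Polynomial in
/-- A polynomial `g` of degree less than `p` that takes proportional values at `α` and `ζ * α`,
with ratio `ζ ^ k`, is the monomial of degree `k` when `α` has degree at least `p`. -/
theorem aeval_eq_coeff_mul_pow_of_aeval_mul_eq {F L : Type*} [Field F] [Field L] [Algebra F L]
    {p : ℕ} {ζ : F} (hζ : IsPrimitiveRoot ζ p) {α : L} (hα : p ≤ (minpoly F α).natDegree)
    {g : F[X]} (hg : g.degree < p) {k : ℕ} (hk : k < p)
    (h : aeval (algebraMap F L ζ * α) g = algebraMap F L ζ ^ k * aeval α g) :
    aeval α g = algebraMap F L (g.coeff k) * α ^ k := by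
  have hzero : g.comp (C ζ * X) - C (ζ ^ k) * g = 0 := by
    by_contra hne
    have hroot : aeval α (g.comp (C ζ * X) - C (ζ ^ k) * g) = 0 := by
      simp [aeval_comp, h]
    have hdeg : (g.comp (C ζ * X) - C (ζ ^ k) * g).degree < p := by
      rw [degree_lt_iff_coeff_zero] at hg ⊢
      intro m hm
      simp [comp_C_mul_X_coeff, hg m hm, coeff_C_mul, -map_pow]
    have hle := natDegree_le_of_dvd (minpoly.dvd F α hroot) hne
    have := (natDegree_lt_iff_degree_lt hne).2 hdeg
    omega
  have hmon : g = monomial k (g.coeff k) := by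
    ext i
    rw [coeff_monomial]
    split_ifs with hi
    · rw [hi]
    · by_cases hip : i < p
      · have hc := congrArg (fun q => q.coeff i) hzero
        simp only [coeff_sub, comp_C_mul_X_coeff, coeff_C_mul, coeff_zero] at hc
        have hc' : g.coeff i * (ζ ^ i - ζ ^ k) = 0 := by linear_combination hc
        refine (mul_eq_zero.1 hc').resolve_right fun hz => hi ?_
        exact (hζ.pow_inj hip hk (sub_eq_zero.1 hz)).symm
      · exact (degree_lt_iff_coeff_zero g p).1 hg i (not_lt.1 hip)
  conv_lhs => rw [hmon]
  rw [aeval_monomial]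


/-- Let `F` be a field of characteristic zero containing a primitive `p`-th root of
unity, `r ∈ F` an element with no `p`-th root in `F`, and `α` a `p`-th root of `r`
in the algebraic closure of `F`.  Then every `β ∈ F(α)` with `β^p ∈ F` has the form
`β = c · α^m` for some `c ∈ F` and `0 ≤ m < p`. -/
theorem mem_adjoin_pow_mem_iff_unit_mul_pow (p : ℕ) (hp : p.Prime)
    (F : Type*) [Field F] [CharZero F]
    (ζ : F) (hζ : IsPrimitiveRoot ζ p)
    (r : F) (hr : ∀ x : F, x ^ p ≠ r)
    (α : AlgebraicClosure F) (hα : α ^ p = algebraMap F (AlgebraicClosure F) r)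
    (β : AlgebraicClosure F)
    (hβ : β ∈ IntermediateField.adjoin F {α})
    (hβp : β ^ p ∈ (algebraMap F (AlgebraicClosure F)).range) :
    ∃ (c : F) (m : ℕ), m < p ∧ β = algebraMap F (AlgebraicClosure F) c * α ^ m := by
  open Polynomial in
  obtain ⟨b, hb⟩ := hβp
  have : NeZero p := ⟨hp.ne_zero⟩
  have hmonic : (X ^ p - C r).Monic := monic_X_pow_sub_C r hp.ne_zero
  have hmin : minpoly F α = X ^ p - C r :=
    (minpoly.eq_of_irreducible_of_monic (X_pow_sub_C_irreducible_of_prime hp hr)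
      (by simp [hα]) hmonic).symm
  rw [← IntermediateField.mem_toSubalgebra,
    IntermediateField.adjoin_simple_toSubalgebra_of_isAlgebraic (Algebra.IsAlgebraic.isAlgebraic α),
    Algebra.adjoin_singleton_eq_range_aeval] at hβ
  obtain ⟨f, rfl⟩ := hβ
  change algebraMap F _ b = aeval α f ^ p at hb
  change ∃ (c : F) (m : ℕ), m < p ∧ aeval α f = _
  obtain ⟨g, hg, hfg⟩ : ∃ g : F[X], g.degree < p ∧ aeval α f = aeval α g := by
    refine ⟨f %ₘ (X ^ p - C r), ?_, ?_⟩
    · exact (degree_modByMonic_lt f hmonic).trans_eq (degree_X_pow_sub_C hp.pos r)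
    · exact (aeval_modByMonic_eq_self_of_root (by simp [hα])).symm
  rw [hfg] at hb ⊢
  by_cases hg0 : aeval α g = 0
  · exact ⟨0, 0, hp.pos, by simp [hg0]⟩
  have hζ' : IsPrimitiveRoot (algebraMap F (AlgebraicClosure F) ζ) p :=
    hζ.map_of_injective (algebraMap F (AlgebraicClosure F)).injective
  have hpow : aeval (algebraMap F (AlgebraicClosure F) ζ * α) g ^ p = aeval α g ^ p := by
    have hdvd : X ^ p - C r ∣ g ^ p - C b := hmin ▸ minpoly.dvd F α (by simp [hb])
    have hroot : aeval (algebraMap F (AlgebraicClosure F) ζ * α) (X ^ p - C r) = 0 := by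
      simp [mul_pow, hζ'.pow_eq_one, hα]
    have := aeval_eq_zero_of_dvd_aeval_eq_zero hdvd hroot
    rw [← hb]
    simpa [sub_eq_zero] using this
  obtain ⟨k, hk, hkζ⟩ := hζ'.eq_pow_of_pow_eq_one
    (ξ := aeval (algebraMap F (AlgebraicClosure F) ζ * α) g / aeval α g)
    (by rw [div_pow, hpow, div_self (pow_ne_zero p hg0)])
  refine ⟨g.coeff k, k, hk, aeval_eq_coeff_mul_pow_of_aeval_mul_eq hζ ?_ hg hk ?_⟩
  · rw [hmin, natDegree_X_pow_sub_C]
  · rw [hkζ, div_mul_cancel₀ _ hg0]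
end
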